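/- arXiv:math/0302099 — 4 statements merged into one kernel-verified Lean document; each statement's English description precedes it below -/
import Mathlib

section
/- For all 1 ≤ k ≤ n−2, φ_{σ_k} ∘ φ_{σ_{k+1}} ∘ φ_{σ_k} = φ_{σ_{k+1}} ∘ φ_{σ_k} ∘ φ_{σ_{k+1}} as algebra automorphisms of A_n, and for all 1 ≤ k, l ≤ n−1 with |k − l| ≥ 2, φ_{σ_k} ∘ φ_{σ_l} = φ_{σ_l} ∘ φ_{σ_k}. Consequently, the assignment σ_k ↦ φ_{σ_k} extends to a group homomorphism φ: B_n → Aut(A_n). -/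
open scoped BigOperators

/-- Off-diagonal pairs of indices: generators `a_{ij}`, `i ≠ j`. -/
abbrev OffDiag (N : ℕ) := {p : Fin N × Fin N // p.1 ≠ p.2}

/-- The algebra `A_n` for `n = m + 1` strands: the free unital associative `ℤ`-algebra on
the generators `a_{ij}`, `i ≠ j`. -/
abbrev KAlg (m : ℕ) := FreeAlgebra ℤ (OffDiag (m + 1))

/-- `ag i j` is the generator `a_{ij}` for `i ≠ j`, and `-2` on the diagonal. -/
noncomputable def ag {m : ℕ} (i j : Fin (m + 1)) : KAlg m :=
  if h : i = j then (-2 : KAlg m) else FreeAlgebra.ι ℤ (⟨(i, j), h⟩ : OffDiag (m + 1))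

/-- The algebra endomorphism `φ_{σ_k}` of `A_n`. -/
noncomputable def phiSigma {m : ℕ} (k : Fin m) : KAlg m →ₐ[ℤ] KAlg m :=
  FreeAlgebra.lift ℤ (fun p : OffDiag (m + 1) =>
    if p.1.1 = k.castSucc ∧ p.1.2 = k.succ then ag k.succ k.castSucc
    else if p.1.1 = k.succ ∧ p.1.2 = k.castSucc then ag k.castSucc k.succ
    else if p.1.1 = k.castSucc then
      - ag k.succ p.1.2 - ag k.succ k.castSucc * ag k.castSucc p.1.2
    else if p.1.2 = k.castSucc then
      - ag p.1.1 k.succ - ag p.1.1 k.castSucc * ag k.castSucc k.succ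
    else if p.1.1 = k.succ then ag k.castSucc p.1.2
    else if p.1.2 = k.succ then ag p.1.1 k.castSucc
    else ag p.1.1 p.1.2)

/-- The braid relations on the generators `σ_1, …, σ_m` (`m = n - 1`). -/
def braidRels (m : ℕ) : Set (FreeGroup (Fin m)) :=
  {r | (∃ k l : Fin m, (k : ℕ) + 1 = (l : ℕ) ∧
          r = FreeGroup.of k * FreeGroup.of l * FreeGroup.of k *
              (FreeGroup.of l * FreeGroup.of k * FreeGroup.of l)⁻¹) ∨
       (∃ k l : Fin m, (k : ℕ) + 2 ≤ (l : ℕ) ∧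
          r = FreeGroup.of k * FreeGroup.of l * (FreeGroup.of l * FreeGroup.of k)⁻¹)}

/-- The braid group `B_n` on `n = m + 1` strands, presented by `σ_1, …, σ_m`. -/
abbrev BraidGroup (m : ℕ) := PresentedGroup (braidRels m)

/-- The generator `σ_k` of the braid group. -/
def bσ {m : ℕ} (k : Fin m) : BraidGroup m := PresentedGroup.of k


theorem phiSigma_ag {m : ℕ} (k : Fin m) (p q i j : Fin (m+1)) (hp : k.castSucc = p)
    (hq : k.succ = q) (h : i ≠ j) : phiSigma k (ag i j) =
    if i = p ∧ j = q then ag q p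
    else if i = q ∧ j = p then ag p q
    else if i = p then - ag q j - ag q p * ag p j
    else if j = p then - ag i q - ag i p * ag p q
    else if i = q then ag p j
    else if j = q then ag i p
    else ag i j := by
  subst hp hq
  conv_lhs => rw [ag, dif_neg h]
  simp only [phiSigma, FreeAlgebra.lift_ι_apply]

theorem kalg_hom_ext {m : ℕ} (f g : KAlg m →ₐ[ℤ] KAlg m)
    (h : ∀ i j, i ≠ j → f (ag i j) = g (ag i j)) : f = g := by
  apply FreeAlgebra.hom_ext
  funext ⟨⟨i, j⟩, hij⟩
  have := h i j hij
  rw [ag, dif_neg hij] at this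
  exact this

noncomputable def psiSigma {m : ℕ} (k : Fin m) : KAlg m →ₐ[ℤ] KAlg m :=
  FreeAlgebra.lift ℤ (fun p : OffDiag (m + 1) =>
    if p.1.1 = k.castSucc ∧ p.1.2 = k.succ then ag k.succ k.castSucc
    else if p.1.1 = k.succ ∧ p.1.2 = k.castSucc then ag k.castSucc k.succ
    else if p.1.1 = k.succ then
      - ag k.castSucc p.1.2 - ag k.castSucc k.succ * ag k.succ p.1.2
    else if p.1.2 = k.succ then
      - ag p.1.1 k.castSucc - ag p.1.1 k.succ * ag k.succ k.castSucc
    else if p.1.1 = k.castSucc then ag k.succ p.1.2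
    else if p.1.2 = k.castSucc then ag p.1.1 k.succ
    else ag p.1.1 p.1.2)

theorem psiSigma_ag {m : ℕ} (k : Fin m) (p q i j : Fin (m+1)) (hp : k.castSucc = p)
    (hq : k.succ = q) (h : i ≠ j) : psiSigma k (ag i j) =
    if i = p ∧ j = q then ag q p
    else if i = q ∧ j = p then ag p q
    else if i = q then - ag p j - ag p q * ag q j
    else if j = q then - ag i p - ag i q * ag q p
    else if i = p then ag q j
    else if j = p then ag i q
    else ag i j := by
  subst hp hq
  conv_lhs => rw [ag, dif_neg h]
  simp only [psiSigma, FreeAlgebra.lift_ι_apply]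

theorem phi_psi {m : ℕ} (k : Fin m) : (phiSigma k).comp (psiSigma k) = AlgHom.id ℤ _ := by
  obtain ⟨p, hp⟩ : ∃ p, k.castSucc = p := ⟨_, rfl⟩
  obtain ⟨q, hq⟩ : ∃ q, k.succ = q := ⟨_, rfl⟩
  have hpq : p ≠ q := by rw [← hp, ← hq]; exact (Fin.castSucc_lt_succ).ne
  have F := fun i j => phiSigma_ag k p q i j hp hq
  have G := fun i j => psiSigma_ag k p q i j hp hq
  clear hp hq
  apply kalg_hom_ext
  intro i j hij
  have hqp := hpq.symm
  have hi : i = p ∨ i = q ∨ (i ≠ p ∧ i ≠ q) := by tauto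
  have hj : j = p ∨ j = q ∨ (j ≠ p ∧ j ≠ q) := by tauto
  rcases hi with rfl | rfl | ⟨h1, h2⟩ <;>
  rcases hj with rfl | rfl | ⟨h4, h5⟩ <;>
  first
  | exact absurd rfl hij
  | (have hji := hij.symm
     try have h1' := h1.symm
     try have h2' := h2.symm
     try have h4' := h4.symm
     try have h5' := h5.symm
     simp [*]
     try noncomm_ring)

theorem psi_phi {m : ℕ} (k : Fin m) : (psiSigma k).comp (phiSigma k) = AlgHom.id ℤ _ := by
  obtain ⟨p, hp⟩ : ∃ p, k.castSucc = p := ⟨_, rfl⟩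
  obtain ⟨q, hq⟩ : ∃ q, k.succ = q := ⟨_, rfl⟩
  have hpq : p ≠ q := by rw [← hp, ← hq]; exact (Fin.castSucc_lt_succ).ne
  have F := fun i j => phiSigma_ag k p q i j hp hq
  have G := fun i j => psiSigma_ag k p q i j hp hq
  clear hp hq
  apply kalg_hom_ext
  intro i j hij
  have hqp := hpq.symm
  have hi : i = p ∨ i = q ∨ (i ≠ p ∧ i ≠ q) := by tauto
  have hj : j = p ∨ j = q ∨ (j ≠ p ∧ j ≠ q) := by tauto
  rcases hi with rfl | rfl | ⟨h1, h2⟩ <;>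
  rcases hj with rfl | rfl | ⟨h4, h5⟩ <;>
  first
  | exact absurd rfl hij
  | (have hji := hij.symm
     try have h1' := h1.symm
     try have h2' := h2.symm
     try have h4' := h4.symm
     try have h5' := h5.symm
     simp [*]
     try noncomm_ring)

theorem phi_braid {m : ℕ} (k l : Fin m) (h : (k : ℕ) + 1 = (l : ℕ)) :
    (phiSigma k).comp ((phiSigma l).comp (phiSigma k)) =
        (phiSigma l).comp ((phiSigma k).comp (phiSigma l)) := by
  obtain ⟨p, hp⟩ : ∃ p, k.castSucc = p := ⟨_, rfl⟩
  obtain ⟨q, hq⟩ : ∃ q, k.succ = q := ⟨_, rfl⟩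
  obtain ⟨r, hr⟩ : ∃ r, l.succ = r := ⟨_, rfl⟩
  have hq' : l.castSucc = q := by rw [← hq]; ext; simp [h]
  have hpq : p ≠ q := by rw [← hp, ← hq]; simp [Fin.ext_iff]
  have hpr : p ≠ r := by rw [← hp, ← hr]; simp [Fin.ext_iff]; omega
  have hqr : q ≠ r := by rw [← hr, ← hq]; simp [Fin.ext_iff]; omega
  have F := fun i j => phiSigma_ag k p q i j hp hq
  have G := fun i j => phiSigma_ag l q r i j hq' hr
  clear hp hq hq' hr
  have hqp := hpq.symm
  have hrp := hpr.symm
  have hrq := hqr.symm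
  apply kalg_hom_ext
  intro i j hij
  have hi : i = p ∨ i = q ∨ i = r ∨ (i ≠ p ∧ i ≠ q ∧ i ≠ r) := by tauto
  have hj : j = p ∨ j = q ∨ j = r ∨ (j ≠ p ∧ j ≠ q ∧ j ≠ r) := by tauto
  rcases hi with rfl | rfl | rfl | ⟨h1, h2, h3⟩ <;>
  rcases hj with rfl | rfl | rfl | ⟨h4, h5, h6⟩ <;>
  first
  | exact absurd rfl hij
  | (have hji := hij.symm
     try have h1' := h1.symm
     try have h2' := h2.symm
     try have h3' := h3.symm
     try have h4' := h4.symm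
     try have h5' := h5.symm
     try have h6' := h6.symm
     simp [*]
     try noncomm_ring)

theorem phi_comm {m : ℕ} (k l : Fin m) (h : (k : ℕ) + 2 ≤ (l : ℕ)) :
    (phiSigma k).comp (phiSigma l) = (phiSigma l).comp (phiSigma k) := by
  obtain ⟨p, hp⟩ : ∃ p, k.castSucc = p := ⟨_, rfl⟩
  obtain ⟨q, hq⟩ : ∃ q, k.succ = q := ⟨_, rfl⟩
  obtain ⟨r, hr⟩ : ∃ r, l.castSucc = r := ⟨_, rfl⟩
  obtain ⟨s, hs⟩ : ∃ s, l.succ = s := ⟨_, rfl⟩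
  have hpq : p ≠ q := by rw [← hp, ← hq]; simp [Fin.ext_iff]
  have hpr : p ≠ r := by rw [← hp, ← hr]; simp [Fin.ext_iff]; omega
  have hps : p ≠ s := by rw [← hp, ← hs]; simp [Fin.ext_iff]; omega
  have hqr : q ≠ r := by rw [← hr, ← hq]; simp [Fin.ext_iff]; omega
  have hqs : q ≠ s := by rw [← hs, ← hq]; simp [Fin.ext_iff]; omega
  have hrs : r ≠ s := by rw [← hs, ← hr]; simp [Fin.ext_iff]
  have F := fun i j => phiSigma_ag k p q i j hp hq
  have G := fun i j => phiSigma_ag l r s i j hr hs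
  clear hp hq hr hs
  have hqp := hpq.symm
  have hrp := hpr.symm
  have hrq := hqr.symm
  have hsp := hps.symm
  have hsq := hqs.symm
  have hsr := hrs.symm
  apply kalg_hom_ext
  intro i j hij
  have hi : i = p ∨ i = q ∨ i = r ∨ i = s ∨ (i ≠ p ∧ i ≠ q ∧ i ≠ r ∧ i ≠ s) := by tauto
  have hj : j = p ∨ j = q ∨ j = r ∨ j = s ∨ (j ≠ p ∧ j ≠ q ∧ j ≠ r ∧ j ≠ s) := by tauto
  rcases hi with rfl | rfl | rfl | rfl | ⟨h1, h2, h3, h7⟩ <;>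
  rcases hj with rfl | rfl | rfl | rfl | ⟨h4, h5, h6, h8⟩ <;>
  first
  | exact absurd rfl hij
  | (have hji := hij.symm
     try have h1' := h1.symm
     try have h2' := h2.symm
     try have h3' := h3.symm
     try have h4' := h4.symm
     try have h5' := h5.symm
     try have h6' := h6.symm
     try have h7' := h7.symm
     try have h8' := h8.symm
     simp [*]
     try noncomm_ring)

noncomputable def phiEquiv {m : ℕ} (k : Fin m) : KAlg m ≃ₐ[ℤ] KAlg m :=
  AlgEquiv.ofAlgHom (phiSigma k) (psiSigma k) (phi_psi k) (psi_phi k)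

/-- the maps `φ_{σ_k}` satisfy the braid relations, and consequently
`σ_k ↦ φ_{σ_k}` extends to a group homomorphism `φ : B_n → Aut(A_n)`. -/
theorem braid_relations_and_phi_extends (m : ℕ) (hm : 1 ≤ m) :
    (∀ k l : Fin m, (k : ℕ) + 1 = (l : ℕ) →
      (phiSigma k).comp ((phiSigma l).comp (phiSigma k)) =
        (phiSigma l).comp ((phiSigma k).comp (phiSigma l))) ∧
    (∀ k l : Fin m, ((k : ℕ) + 2 ≤ (l : ℕ) ∨ (l : ℕ) + 2 ≤ (k : ℕ)) →
      (phiSigma k).comp (phiSigma l) = (phiSigma l).comp (phiSigma k)) ∧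
    (∃ φ : BraidGroup m →* (KAlg m ≃ₐ[ℤ] KAlg m),
      ∀ (k : Fin m) (x : KAlg m), φ (bσ k) x = phiSigma k x) := by
  refine ⟨phi_braid, ?_, ?_⟩
  · rintro k l (h | h)
    · exact phi_comm k l h
    · exact (phi_comm l k h).symm
  · have hrel : ∀ r ∈ braidRels m, FreeGroup.lift (phiEquiv (m := m)) r = 1 := by
      rintro r (⟨k, l, h, rfl⟩ | ⟨k, l, h, rfl⟩)
      · rw [map_mul, map_inv, mul_inv_eq_one]
        simp only [map_mul, FreeGroup.lift_apply_of]
        ext1 x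
        exact DFunLike.congr_fun (phi_braid k l h) x
      · rw [map_mul, map_inv, mul_inv_eq_one]
        simp only [map_mul, FreeGroup.lift_apply_of]
        ext1 x
        exact DFunLike.congr_fun (phi_comm k l h) x
    refine ⟨PresentedGroup.toGroup hrel, fun k x => ?_⟩
    rw [bσ, PresentedGroup.toGroup.of]
    rfl
end

section
/- Let B, C ∈ B_n and set B̃ = C^{−1}BC. Then the automorphism φ_C of A_n maps the ideal I^braid_{B̃} onto the ideal I^braid_B; consequently φ_C induces a ring isomorphism HC_0(B̃) ≅ HC_0(B). In particular, up to ring isomorphism, HC_0(B) depends only on the conjugacy class of B in B_n. -/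
open scoped BigOperators

/-- The inclusion `A_n → A_{n+1}` (the extra strand `*` is the last index). -/
noncomputable def embA (m : ℕ) : KAlg m →ₐ[ℤ] KAlg (m + 1) :=
  FreeAlgebra.lift ℤ (fun p : OffDiag (m + 1) =>
    ag (Fin.castSucc p.1.1) (Fin.castSucc p.1.2))

/-- The matrix `A`, with entries `a_{ij}` off the diagonal and `-2` on the diagonal. -/
noncomputable def matA (m : ℕ) : Matrix (Fin (m + 1)) (Fin (m + 1)) (KAlg m) :=
  Matrix.of fun i j => ag i j

/-- `P` is the matrix `Φ^L_B(A)`, relative to `φ^ext`. -/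
def IsPhiL {m : ℕ}
    (φext : BraidGroup m →* (KAlg (m + 1) ≃ₐ[ℤ] KAlg (m + 1)))
    (B : BraidGroup m) (P : Matrix (Fin (m + 1)) (Fin (m + 1)) (KAlg m)) : Prop :=
  ∀ i : Fin (m + 1),
    φext B (ag (Fin.castSucc i) (Fin.last (m + 1))) =
      ∑ j : Fin (m + 1), embA m (P i j) * ag (Fin.castSucc j) (Fin.last (m + 1))

/-- `P` is the matrix `Φ^R_B(A)`, relative to `φ^ext`. -/
def IsPhiR {m : ℕ}
    (φext : BraidGroup m →* (KAlg (m + 1) ≃ₐ[ℤ] KAlg (m + 1)))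
    (B : BraidGroup m) (P : Matrix (Fin (m + 1)) (Fin (m + 1)) (KAlg m)) : Prop :=
  ∀ j : Fin (m + 1),
    φext B (ag (Fin.last (m + 1)) (Fin.castSucc j)) =
      ∑ i : Fin (m + 1), ag (Fin.castSucc i) (Fin.last (m + 1)) * embA m (P i j)

/-- The ideal `I^braid_B`. -/
noncomputable def Ibraid {m : ℕ} (φ : BraidGroup m →* (KAlg m ≃ₐ[ℤ] KAlg m))
    (B : BraidGroup m) : TwoSidedIdeal (KAlg m) :=
  TwoSidedIdeal.span {x | ∃ i j : Fin (m + 1), i ≠ j ∧ x = ag i j - φ B (ag i j)}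

/-- The ideal `I^knot_B`, given the matrices `P = Φ^L_B(A)` and `Q = Φ^R_B(A)`. -/
noncomputable def Iknot {m : ℕ} (P Q : Matrix (Fin (m + 1)) (Fin (m + 1)) (KAlg m)) :
    TwoSidedIdeal (KAlg m) :=
  TwoSidedIdeal.span
    ({x | ∃ i j, x = ((1 - P) * matA m) i j} ∪ {x | ∃ i j, x = (matA m * (1 - Q)) i j})

/-- The conjugation involution of `A_n`: the anti-automorphism `a_{ij} ↦ a_{ji}`. -/
noncomputable def conjA (m : ℕ) : KAlg m → KAlg m := fun x =>
  ((FreeAlgebra.lift ℤ (fun p : OffDiag (m + 1) =>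
      MulOpposite.op (ag p.1.2 p.1.1)) : KAlg m →ₐ[ℤ] (KAlg m)ᵐᵒᵖ) x).unop

theorem sub_mem_Ibraid {m : ℕ} (φ : BraidGroup m →* (KAlg m ≃ₐ[ℤ] KAlg m))
    (B : BraidGroup m) (x : KAlg m) : x - φ B x ∈ Ibraid φ B := by
  induction x using FreeAlgebra.induction with
  | grade0 r =>
    rw [AlgEquiv.commutes, sub_self]
    exact TwoSidedIdeal.zero_mem _
  | grade1 p =>
    refine TwoSidedIdeal.subset_span ⟨p.1.1, p.1.2, p.2, ?_⟩
    have h : ag p.1.1 p.1.2 = FreeAlgebra.ι ℤ p := by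
      unfold ag
      rw [dif_neg p.2]
    rw [h]
  | mul a b ha hb =>
    have h : a * b - φ B (a * b) = (a - φ B a) * b + φ B a * (b - φ B b) := by
      rw [map_mul]; noncomm_ring
    rw [h]
    exact TwoSidedIdeal.add_mem _ (TwoSidedIdeal.mul_mem_right _ _ _ ha)
      (TwoSidedIdeal.mul_mem_left _ _ _ hb)
  | add a b ha hb =>
    have h : a + b - φ B (a + b) = (a - φ B a) + (b - φ B b) := by
      rw [map_add]; abel
    rw [h]
    exact TwoSidedIdeal.add_mem _ ha hb

theorem map_mem_Ibraid {m : ℕ} (φ : BraidGroup m →* (KAlg m ≃ₐ[ℤ] KAlg m))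
    (B B' C : BraidGroup m) (hB : C * B' = B * C) (x : KAlg m) (hx : x ∈ Ibraid φ B') :
    φ C x ∈ Ibraid φ B := by
  have h : Ibraid φ B' ≤ TwoSidedIdeal.comap (φ C) (Ibraid φ B) := by
    unfold Ibraid
    rw [TwoSidedIdeal.span_le]
    rintro _ ⟨i, j, -, rfl⟩
    change _ ∈ TwoSidedIdeal.comap (φ C) (Ibraid φ B)
    rw [TwoSidedIdeal.mem_comap, map_sub, ← AlgEquiv.mul_apply, ← map_mul, hB, map_mul,
      AlgEquiv.mul_apply]
    exact sub_mem_Ibraid φ B _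
  exact (TwoSidedIdeal.mem_comap _).1 (h hx)

theorem map_mem_Ibraid_iff {m : ℕ} (φ : BraidGroup m →* (KAlg m ≃ₐ[ℤ] KAlg m))
    (B C : BraidGroup m) (x : KAlg m) :
    φ C x ∈ Ibraid φ B ↔ x ∈ Ibraid φ (C⁻¹ * B * C) := by
  refine ⟨fun h => ?_, map_mem_Ibraid φ B _ C (by group) x⟩
  have h2 := map_mem_Ibraid φ (C⁻¹ * B * C) B C⁻¹ (by group) _ h
  rwa [← AlgEquiv.mul_apply, ← map_mul, inv_mul_cancel, map_one, AlgEquiv.one_apply] at h2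

/-- for `B̃ = C⁻¹BC`, the automorphism `φ_C` maps `I^braid_{B̃}` onto
`I^braid_B`, and consequently induces a ring isomorphism `HC₀(B̃) ≅ HC₀(B)`; so `HC₀`
depends only on the conjugacy class. -/
theorem HC0_braid_conjugacy_invariance (m : ℕ) (hm : 1 ≤ m)
    (φ : BraidGroup m →* (KAlg m ≃ₐ[ℤ] KAlg m))
    (hφ : ∀ (k : Fin m) (x : KAlg m), φ (bσ k) x = phiSigma k x)
    (B C : BraidGroup m) :
    (φ C) '' ((Ibraid φ (C⁻¹ * B * C) : TwoSidedIdeal (KAlg m)) : Set (KAlg m)) =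
      ((Ibraid φ B : TwoSidedIdeal (KAlg m)) : Set (KAlg m)) ∧
    Nonempty ((Ibraid φ (C⁻¹ * B * C)).ringCon.Quotient ≃+* (Ibraid φ B).ringCon.Quotient) := by
  refine ⟨?_, ⟨RingCon.congr (φ C).toRingEquiv ?_⟩⟩
  · ext y
    constructor
    · rintro ⟨x, hx, rfl⟩
      exact (map_mem_Ibraid_iff φ B C x).2 hx
    · intro hy
      obtain ⟨x, rfl⟩ := (φ C).surjective y
      exact ⟨x, (map_mem_Ibraid_iff φ B C x).1 hy, rfl⟩
  · ext x y
    rw [TwoSidedIdeal.rel_iff, RingCon.comap_rel, TwoSidedIdeal.rel_iff,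
      ← map_mem_Ibraid_iff φ B C, map_sub]
    rfl
end

section
/- For every B ∈ B_n and every v ∈ A_n, φ_B(v̄) = the conjugate of φ_B(v); that is, each φ_B commutes with the conjugation involution of A_n. -/
open scoped BigOperators

theorem conjA_mul' (m : ℕ) (x y : KAlg m) : conjA m (x * y) = conjA m y * conjA m x := by
  simp [conjA]

theorem conjA_add' (m : ℕ) (x y : KAlg m) : conjA m (x + y) = conjA m x + conjA m y := by
  simp [conjA]

theorem conjA_neg' (m : ℕ) (x : KAlg m) : conjA m (-x) = -conjA m x := by
  simp [conjA]

theorem conjA_sub' (m : ℕ) (x y : KAlg m) : conjA m (x - y) = conjA m x - conjA m y := by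
  simp [conjA]

theorem conjA_algebraMap' (m : ℕ) (r : ℤ) :
    conjA m (algebraMap ℤ (KAlg m) r) = algebraMap ℤ (KAlg m) r := by
  unfold conjA
  rw [AlgHom.commutes]
  rfl

theorem conjA_ag (m : ℕ) (i j : Fin (m + 1)) : conjA m (ag i j) = ag j i := by
  by_cases h : i = j
  · subst h
    have h2 : (ag i i : KAlg m) = algebraMap ℤ (KAlg m) (-2) := by simp [ag]
    rw [h2, conjA_algebraMap']
  · have h2 : (ag i j : KAlg m) = FreeAlgebra.ι ℤ (⟨(i, j), h⟩ : OffDiag (m + 1)) := by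
      simp [ag, h]
    rw [h2]
    unfold conjA
    rw [FreeAlgebra.lift_ι_apply]
    rfl

theorem phiSigma_ag_conj {m : ℕ} (k : Fin m) (i j : Fin (m + 1)) (h : i ≠ j) :
    phiSigma k (ag j i) = conjA m (phiSigma k (ag i j)) := by
  have h2 : (ag i j : KAlg m) = FreeAlgebra.ι ℤ (⟨(i, j), h⟩ : OffDiag (m + 1)) := by
    simp [ag, h]
  have h3 : (ag j i : KAlg m) = FreeAlgebra.ι ℤ (⟨(j, i), h.symm⟩ : OffDiag (m + 1)) := by
    simp [ag, h.symm]
  have hk : k.castSucc ≠ k.succ := (Fin.castSucc_lt_succ (i := k)).ne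
  rw [h2, h3]
  unfold phiSigma
  rw [FreeAlgebra.lift_ι_apply, FreeAlgebra.lift_ι_apply]
  dsimp only
  generalize k.castSucc = a at *
  generalize k.succ = b at *
  clear h2 h3
  by_cases h1 : i = a <;> by_cases h4 : i = b <;> by_cases h5 : j = a <;> by_cases h6 : j = b <;>
    first
    | exact absurd (h1.trans h5.symm) h
    | exact absurd (h4.trans h6.symm) h
    | simp_all [conjA_ag, conjA_sub', conjA_neg', conjA_mul']

theorem phiSigma_conj {m : ℕ} (k : Fin m) (v : KAlg m) :
    phiSigma k (conjA m v) = conjA m (phiSigma k v) := by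
  induction v using FreeAlgebra.induction with
  | grade0 r => rw [conjA_algebraMap', AlgHom.commutes, conjA_algebraMap']
  | grade1 p =>
    have h2 : FreeAlgebra.ι ℤ p = (ag p.1.1 p.1.2 : KAlg m) := by
      simp [ag, p.2]
    rw [h2, conjA_ag]
    exact phiSigma_ag_conj k _ _ p.2
  | mul x y hx hy => rw [conjA_mul', map_mul, map_mul, conjA_mul', hx, hy]
  | add x y hx hy => rw [conjA_add', map_add, map_add, conjA_add', hx, hy]

/-- every `φ_B` commutes with the conjugation involution of `A_n`. -/
theorem phi_commutes_with_conjugation (m : ℕ) (hm : 1 ≤ m)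
    (φ : BraidGroup m →* (KAlg m ≃ₐ[ℤ] KAlg m))
    (hφ : ∀ (k : Fin m) (x : KAlg m), φ (bσ k) x = phiSigma k x)
    (B : BraidGroup m) (v : KAlg m) :
    φ B (conjA m v) = conjA m (φ B v) := by
  have hB : B ∈ Subgroup.closure (Set.range (PresentedGroup.of (rels := braidRels m))) := by
    rw [PresentedGroup.closure_range_of]
    trivial
  induction hB using Subgroup.closure_induction generalizing v with
  | mem x hx =>
    obtain ⟨k, rfl⟩ := hx
    have := hφ k
    unfold bσ at this
    rw [this, this, phiSigma_conj]
  | one => simp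
  | mul x y _ _ hx hy => rw [map_mul, AlgEquiv.mul_apply, AlgEquiv.mul_apply, hy, hx]
  | inv x _ hx =>
    apply (φ x).injective
    rw [hx, ← AlgEquiv.mul_apply, ← AlgEquiv.mul_apply, ← map_mul, mul_inv_cancel, map_one]
    rfl
end

section
/- For every integer ℓ and every integer m ≥ 0, the polynomial p_m(x) divides q_{ℓ+2m−1}(x) − q_ℓ(x) in ℤ[x]. -/
/-- The polynomials `q_m`: `q_0 = -2`, `q_1 = -x`, `q_{m+1} = x·q_m - q_{m-1}`. -/
noncomputable def qPol : ℕ → Polynomial ℤ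
  | 0 => -2
  | 1 => -Polynomial.X
  | (m + 2) => Polynomial.X * qPol (m + 1) - qPol m

/-- The extension of `q` to all integers via the recursion; it satisfies `q_{-m} = q_m`. -/
noncomputable def qZ (k : ℤ) : Polynomial ℤ := qPol k.natAbs

/-- The polynomials `p_m`: `p_0 = 2 - x`, `p_1 = x - 2`, `p_{m+1} = x·p_m - p_{m-1}`. -/
noncomputable def pPol : ℕ → Polynomial ℤ
  | 0 => 2 - Polynomial.X
  | 1 => Polynomial.X - 2
  | (m + 2) => Polynomial.X * pPol (m + 1) - pPol m

theorem aux_rec (k : ℤ) : qZ (k + 1) = Polynomial.X * qZ k - qZ (k - 1) := by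
  unfold qZ
  rcases lt_trichotomy k 0 with h | h | h
  · obtain ⟨n, rfl⟩ : ∃ n : ℕ, k = -(n : ℤ) - 1 := ⟨(-k - 1).toNat, by omega⟩
    have h1 : (-(n : ℤ) - 1 + 1).natAbs = n := by omega
    have h2 : (-(n : ℤ) - 1).natAbs = n + 1 := by omega
    have h3 : (-(n : ℤ) - 1 - 1).natAbs = n + 2 := by omega
    rw [h1, h2, h3, qPol]
    ring
  · subst h
    simp [qPol]
    ring
  · obtain ⟨n, rfl⟩ : ∃ n : ℕ, k = (n : ℤ) + 1 := ⟨(k - 1).toNat, by omega⟩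
    have h1 : ((n : ℤ) + 1 + 1).natAbs = n + 2 := by omega
    have h2 : ((n : ℤ) + 1).natAbs = n + 1 := by omega
    have h3 : ((n : ℤ) + 1 - 1).natAbs = n := by omega
    rw [h1, h2, h3, qPol]

theorem aux_mod (n : ℕ) : ∃ w, qPol n = -2 + (Polynomial.X - 2) * w := by
  induction n using Nat.twoStepInduction with
  | zero => exact ⟨0, by simp [qPol]⟩
  | one => exact ⟨-1, by simp only [qPol]; ring⟩
  | more n h1 h2 =>
    obtain ⟨a, ha⟩ := h1
    obtain ⟨b, hb⟩ := h2
    exact ⟨-2 + Polynomial.X * b - a, by rw [qPol, ha, hb]; ring⟩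

theorem aux_main (k : ℤ) (w : Polynomial ℤ)
    (hw : qZ k - qZ (k - 1) = (Polynomial.X - 2) * w) (m : ℕ) :
    qZ (k + m - 1) - qZ (k - m) = pPol m * w := by
  induction m using Nat.twoStepInduction with
  | zero =>
    simp only [pPol, Nat.cast_zero, add_zero, sub_zero]
    linear_combination -hw
  | one =>
    simp only [pPol, Nat.cast_one, add_sub_cancel_right]
    exact hw
  | more n h1 h2 =>
    have e1 := aux_rec (k + n)
    have e2 := aux_rec (k - n - 1)
    have a1 : k + ((n + 2 : ℕ) : ℤ) - 1 = k + n + 1 := by push_cast; ring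
    have a2 : k - ((n + 2 : ℕ) : ℤ) = k - n - 1 - 1 := by push_cast; ring
    have a3 : k + ((n + 1 : ℕ) : ℤ) - 1 = k + n := by push_cast; ring
    have a4 : k - ((n + 1 : ℕ) : ℤ) = k - n - 1 := by push_cast; ring
    rw [sub_add_cancel] at e2
    rw [a3, a4] at h2
    rw [a1, a2, pPol]
    linear_combination e1 - e2 + Polynomial.X * h2 - h1

/-- `p_m(x)` divides `q_{ℓ+2m-1}(x) - q_ℓ(x)` in `ℤ[x]`. -/
theorem p_divides_q_difference (ℓ : ℤ) (m : ℕ) :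
    pPol m ∣ qZ (ℓ + 2 * (m : ℤ) - 1) - qZ ℓ := by
  obtain ⟨a, ha⟩ := aux_mod (ℓ + m).natAbs
  obtain ⟨b, hb⟩ := aux_mod (ℓ + m - 1).natAbs
  have h := aux_main (ℓ + m) (a - b) (by unfold qZ; rw [ha, hb]; ring) m
  refine ⟨a - b, ?_⟩
  rw [← h]
  congr 2 <;> ring
end
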